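/- Let A0 ⊆ V ∖ {0} be a nonempty open convex conic subset, Ā0 its closure in V ∖ {0}, and C0 := Ā0 ∖ A0. If C0 is salient, then there exists a linear form ω : V → ℝ such that ω(v) > 0 for every v ∈ Ā0. Consequently, the affine hyperplane ω⁻¹(1) meets every radial half-line {λv : λ > 0} with v ∈ Ā0 in exactly one point. -/

import Mathlib

open Set Module

noncomputable section

variable {V : Type*} [NormedAddCommGroup V] [NormedSpace ℝ V]

/-- A subset of `V` is conic if stable under multiplication by positive scalars. -/
def Conic (s : Set V) : Prop := ∀ v ∈ s, ∀ c : ℝ, 0 < c → c • v ∈ s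

/-- Salient: contains no pair of opposite vectors. -/
def Salient (s : Set V) : Prop := ∀ v ∈ s, -v ∉ s

/-- The closure of a conic set is conic. -/
theorem Conic.closure {s : Set V} (hs : Conic s) : Conic (closure s) := fun _ hv c hc =>
  map_mem_closure (continuous_const_smul c) hv fun x hx => hs x hx c hc

/-- A convex conic open set avoiding `0` whose boundary cone is salient has a salient
punctured closure. -/
theorem salient_closure_diff_zero {s : Set V} (h0 : (0 : V) ∉ s) (hop : IsOpen s)
    (hconv : Convex ℝ s) (hsal : Salient ((closure s \ {0}) \ s)) :
    Salient (closure s \ {0}) := by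
  have key : ∀ v ∈ s, -v ∉ closure s := fun v hv hnv => by
    have hmem : (0 : V) ∈ interior s :=
      hconv.openSegment_interior_closure_subset_interior (hop.interior_eq.symm ▸ hv) hnv
        ⟨1 / 2, 1 / 2, by norm_num, by norm_num, by norm_num, by simp⟩
    exact h0 (interior_subset hmem)
  intro v hv hnv
  have hvs : v ∉ s := fun h => key v h hnv.1
  have hnvs : -v ∉ s := fun h => key (-v) h (by simpa using hv.1)
  exact hsal v ⟨hv, hvs⟩ ⟨hnv, hnvs⟩

/-- A point outside a closed convex cone is separated from it by a continuous linear form which is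
nonnegative on the cone. -/
theorem exists_nonneg_on_cone_neg_at {s : Set V} (hclosed : IsClosed s) (hconv : Convex ℝ s)
    (hconic : Conic s) (h0 : (0 : V) ∈ s) {x : V} (hx : x ∉ s) :
    ∃ f : V →L[ℝ] ℝ, (∀ v ∈ s, 0 ≤ f v) ∧ f x < 0 := by
  obtain ⟨f, u, hxu, hf⟩ := geometric_hahn_banach_point_closed hconv hclosed hx
  have hu : u < 0 := by simpa using hf 0 h0
  refine ⟨f, fun v hv => ?_, hxu.trans hu⟩
  by_contra! hneg
  have hlt := hf _ (hconic v hv (u / f v) (div_pos_of_neg_of_neg hu hneg))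
  rw [map_smul, smul_eq_mul, div_mul_cancel₀ _ hneg.ne] at hlt
  exact hlt.false

/-- A closed convex cone that is salient away from the origin admits a linear form which is
positive on its nonzero vectors. -/
theorem exists_pos_linear_form_of_salient [FiniteDimensional ℝ V] {s : Set V}
    (hclosed : IsClosed s) (hconv : Convex ℝ s) (hconic : Conic s) (h0 : (0 : V) ∈ s)
    (hsal : Salient (s \ {0})) :
    ∃ ω : V →ₗ[ℝ] ℝ, ∀ v ∈ s \ {0}, 0 < ω v := by
  have : ProperSpace V := FiniteDimensional.proper ℝ V
  have hcompact : IsCompact (Metric.sphere (0 : V) 1 ∩ s) :=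
    (isCompact_sphere 0 1).inter_right hclosed
  obtain ⟨f, -, hpos⟩ : ∃ f : V →L[ℝ] ℝ, (∀ v ∈ s, 0 ≤ f v) ∧
      ∀ v ∈ Metric.sphere (0 : V) 1 ∩ s, v ∈ s → 0 < f v := by
    refine hcompact.induction_on
      (p := fun t => ∃ f : V →L[ℝ] ℝ, (∀ v ∈ s, 0 ≤ f v) ∧ ∀ v ∈ t, v ∈ s → 0 < f v)
      ⟨0, by simp, by simp⟩ ?_ ?_ ?_
    · rintro t t' htt' ⟨f, hf, hft⟩
      exact ⟨f, hf, fun v hv => hft v (htt' hv)⟩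
    · rintro t t' ⟨f, hf, hft⟩ ⟨g, hg, hgt⟩
      refine ⟨f + g, fun v hv => add_nonneg (hf v hv) (hg v hv), ?_⟩
      rintro v (hv | hv) hvs
      · exact add_pos_of_pos_of_nonneg (hft v hv hvs) (hg v hvs)
      · exact add_pos_of_nonneg_of_pos (hf v hvs) (hgt v hv hvs)
    · intro v hv
      have hv0 : v ≠ 0 := ne_zero_of_mem_unit_sphere ⟨v, hv.1⟩
      obtain ⟨f, hf, hfv⟩ := exists_nonneg_on_cone_neg_at hclosed hconv hconic h0
        fun h => hsal v ⟨hv.2, hv0⟩ ⟨h, neg_ne_zero.2 hv0⟩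
      rw [map_neg, neg_lt_zero] at hfv
      exact ⟨{w | 0 < f w}, mem_nhdsWithin_of_mem_nhds
        ((isOpen_lt continuous_const f.continuous).mem_nhds hfv), f, hf, fun w hw _ => hw⟩
  refine ⟨f, fun v hv => ?_⟩
  have hnorm : 0 < ‖v‖ := norm_pos_iff.2 hv.2
  have hmem := hconic v hv.1 _ (inv_pos.2 hnorm)
  have hlt := hpos _ ⟨by simp [norm_smul, hnorm.ne'], hmem⟩ hmem
  rw [map_smul, smul_eq_mul] at hlt
  exact pos_of_mul_pos_right hlt (inv_pos.2 hnorm).le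

/-- The origin is in the closure of every nonempty conic set. -/
theorem Conic.zero_mem_closure {s : Set V} (hs : Conic s) (hne : s.Nonempty) :
    (0 : V) ∈ _root_.closure s := by
  obtain ⟨v, hv⟩ := hne
  have hmem : (0 : ℝ) ∈ _root_.closure (Ioi 0) := by simp
  simpa using map_mem_closure (continuous_id.smul continuous_const) hmem fun c hc => hs v hv c hc

/-- a convex conic open domain with salient boundary cone admits a
linear form positive on its closure in `V ∖ {0}`; consequently the affine hyperplane
`ω⁻¹(1)` crosses each radial half-line of `Ā₀` exactly once. -/
theorem stmt_16 [FiniteDimensional ℝ V] (hn : 2 ≤ finrank ℝ V)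
    (A₀ : Set V) (hNe : A₀.Nonempty) (h0 : (0 : V) ∉ A₀)
    (hop : IsOpen A₀) (hconv : Convex ℝ A₀) (hconic : Conic A₀)
    (hsal : Salient ((closure A₀ \ {0}) \ A₀)) :
    ∃ ω : V →ₗ[ℝ] ℝ,
      (∀ v ∈ closure A₀ \ {0}, 0 < ω v) ∧
      (∀ v ∈ closure A₀ \ {0}, ∃! c : ℝ, 0 < c ∧ ω (c • v) = 1) := by
  obtain ⟨ω, hω⟩ := exists_pos_linear_form_of_salient isClosed_closure hconv.closure
    hconic.closure (hconic.zero_mem_closure hNe)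
    (salient_closure_diff_zero h0 hop hconv hsal)
  refine ⟨ω, hω, fun v hv => ⟨(ω v)⁻¹, ⟨inv_pos.2 (hω v hv), ?_⟩, fun c hc => ?_⟩⟩
  · simp [(hω v hv).ne']
  · exact eq_inv_of_mul_eq_one_left (by simpa using hc.2)
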